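/- arXiv:1501.02463 — 3 statements merged into one kernel-verified Lean document; each statement's English description precedes it below -/
import Mathlib

section
/- Let 𝓛 be a restriction list and let L(Ψ) be an 𝓛-acceptable invariant of Ψ of degree σ with no traces in any term, and let M be the maximum number of special contractions Ψ^1_ā Ψ^σ_a among its terms. If every term of the sublinear combination [M‖L(Ψ)] (the terms with exactly M special contractions) satisfies A_σ > α_σ and B_1 > β_1, then there exist one-form valued 𝓛-acceptable invariants T_a(Ψ), T_ā(Ψ), containing no traces and with free index not belonging to the factor on ψ^1, such that [M‖L(Ψ)] = ∂_ā T_a(Ψ) + ∂_a T_ā(Ψ) + L^{M−}(Ψ), where L^{M−}(Ψ) is a finite linear combination of 𝓛-acceptable complete contractions containing no traces and at most M − 1 special contractions. -/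
open MeasureTheory

noncomputable section

namespace KahlerInv

/-- The Wirtinger holomorphic derivative `∂/∂z_a` on `ℂⁿ`. -/
def dz (n : ℕ) (a : Fin n) (f : (Fin n → ℂ) → ℂ) : (Fin n → ℂ) → ℂ :=
  fun z => (1 / 2 : ℂ) *
    (fderiv ℝ f z (Pi.single a 1) - Complex.I * fderiv ℝ f z (Pi.single a Complex.I))

/-- The Wirtinger anti-holomorphic derivative `∂/∂z̄_a` on `ℂⁿ`. -/
def dzbar (n : ℕ) (a : Fin n) (f : (Fin n → ℂ) → ℂ) : (Fin n → ℂ) → ℂ :=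
  fun z => (1 / 2 : ℂ) *
    (fderiv ℝ f z (Pi.single a 1) + Complex.I * fderiv ℝ f z (Pi.single a Complex.I))

/-- The iterated mixed Wirtinger derivative `∂^{(A,B)}` with the prescribed
holomorphic indices `hs` and anti-holomorphic indices `as`. -/
def mixedDeriv (n : ℕ) {A B : ℕ} (hs : Fin A → Fin n) (as : Fin B → Fin n)
    (f : (Fin n → ℂ) → ℂ) : (Fin n → ℂ) → ℂ :=
  (List.ofFn hs).foldr (fun a g => dz n a g)
    ((List.ofFn as).foldr (fun a g => dzbar n a g) f)

/-- `f : ℂⁿ → ℝ` is smooth and compactly supported. -/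
def SmoothCpt (n : ℕ) (f : (Fin n → ℂ) → ℝ) : Prop :=
  ContDiff ℝ (⊤ : ℕ∞) f ∧ HasCompactSupport f

/-- A formal (complete or partial) contraction of degree `σ`, with `p` free
holomorphic indices and `q` free anti-holomorphic indices.  The factor on
`ψ^j` carries `A j` holomorphic and `B j` anti-holomorphic index slots.
The bijection `pair` matches every holomorphic slot either with an
anti-holomorphic slot (a contracted pair) or with a free holomorphic label
in `Fin p`; a label `i : Fin q` on the left corresponds to the
anti-holomorphic slot `pair (Sum.inr i)`, which is the `i`-th free
anti-holomorphic index. -/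
structure Term (σ p q : ℕ) where
  A : Fin σ → ℕ
  B : Fin σ → ℕ
  pair : ((Σ j : Fin σ, Fin (A j)) ⊕ Fin q) ≃ ((Σ j : Fin σ, Fin (B j)) ⊕ Fin p)
  okq : ∀ i : Fin q, (pair (Sum.inr i)).isLeft
  okp : ∀ i : Fin p, (pair.symm (Sum.inr i)).isLeft

namespace Term

variable {σ p q : ℕ}

/-- The type of holomorphic index slots. -/
abbrev HoloIdx (T : Term σ p q) : Type := Σ j : Fin σ, Fin (T.A j)

/-- The type of anti-holomorphic index slots. -/
abbrev AntiIdx (T : Term σ p q) : Type := Σ j : Fin σ, Fin (T.B j)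

open Classical in
/-- Evaluation of a formal contraction on the tuple `Ψ` of functions, with
values `fh` (resp. `fa`) assigned to the free holomorphic (resp.
anti-holomorphic) indices, at the point `z`.  Each contracted pair of indices
is summed over `Fin n`. -/
def eval (n : ℕ) (T : Term σ p q) (Ψ : Fin σ → (Fin n → ℂ) → ℝ)
    (fh : Fin p → Fin n) (fa : Fin q → Fin n) (z : Fin n → ℂ) : ℂ :=
  ∑ v : (T.HoloIdx ⊕ Fin q) → Fin n,
    (if (∀ i : Fin q, v (Sum.inr i) = fa i) ∧
        (∀ (s : T.HoloIdx) (i : Fin p),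
          T.pair (Sum.inl s) = Sum.inr i → v (Sum.inl s) = fh i)
      then (1 : ℂ) else 0) *
    ∏ j : Fin σ,
      mixedDeriv n (fun s : Fin (T.A j) => v (Sum.inl ⟨j, s⟩))
        (fun t : Fin (T.B j) => v (T.pair.symm (Sum.inl ⟨j, t⟩)))
        (fun w => (Ψ j w : ℂ)) z

/-- The weight: the total number of contracted pairs. -/
def weight (T : Term σ p q) : ℕ := (∑ j, T.A j) - p

/-- The order `d = Σ_j (A_j + B_j - 4)`. -/
def order (T : Term σ p q) : ℕ := ∑ j, (T.A j + T.B j - 4)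

/-- Acceptability: every factor has `A_j, B_j ≥ 2`. -/
def Acceptable (T : Term σ p q) : Prop := ∀ j, 2 ≤ T.A j ∧ 2 ≤ T.B j

/-- No trace: no contracted pair has both indices in the same factor. -/
def NoTraces (T : Term σ p q) : Prop :=
  ∀ (s : T.HoloIdx) (t : T.AntiIdx), T.pair (Sum.inl s) = Sum.inl t → t.1 ≠ s.1

open Classical in
/-- The number of traces in factor `j`. -/
def tracesAt (T : Term σ p q) (j : Fin σ) : ℕ :=
  (Finset.univ.filter fun s : T.HoloIdx =>
    s.1 = j ∧ ∃ t : T.AntiIdx, T.pair (Sum.inl s) = Sum.inl t ∧ t.1 = j).card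

open Classical in
/-- The height: the total number of traces. -/
def height (T : Term σ p q) : ℕ :=
  (Finset.univ.filter fun s : T.HoloIdx =>
    ∃ t : T.AntiIdx, T.pair (Sum.inl s) = Sum.inl t ∧ t.1 = s.1).card

open Classical in
/-- The number of contractions of an anti-holomorphic index of factor `i`
against a holomorphic index of factor `j` (denoted `Ψ^i_ā Ψ^j_a`). -/
def specialCount (T : Term σ p q) (i j : Fin σ) : ℕ :=
  (Finset.univ.filter fun s : T.HoloIdx =>
    s.1 = j ∧ ∃ t : T.AntiIdx, T.pair (Sum.inl s) = Sum.inl t ∧ t.1 = i).card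

open Classical in
/-- The number of contracted pairs with one index in factor `u` and the
other in factor `v`. -/
def linkCount (T : Term σ p q) (u v : Fin σ) : ℕ :=
  (Finset.univ.filter fun s : T.HoloIdx =>
    ∃ t : T.AntiIdx, T.pair (Sum.inl s) = Sum.inl t ∧
      ((s.1 = u ∧ t.1 = v) ∨ (s.1 = v ∧ t.1 = u))).card

/-- `Π_l(h)`: the number of contractions `Ψ^1_ā Ψ^h_a` plus the number of
contractions `Ψ^h_ā Ψ^σ_a`. -/
def piCount (T : Term σ p q) (h : Fin σ) : ℕ :=
  T.specialCount ⟨0, h.pos⟩ h + T.specialCount h ⟨σ - 1, Nat.sub_lt h.pos Nat.one_pos⟩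

/-- The free index (holomorphic or anti-holomorphic) does not belong to
factor `i`. -/
def FreeNotIn (T : Term σ p q) (i : Fin σ) : Prop :=
  (∀ s : T.HoloIdx, (∃ l : Fin p, T.pair (Sum.inl s) = Sum.inr l) → s.1 ≠ i) ∧
  (∀ t : T.AntiIdx, (∃ l : Fin q, T.pair.symm (Sum.inl t) = Sum.inr l) → t.1 ≠ i)

end Term

/-- A restriction list `𝓛 ∈ {0,1,2}^{2σ}`. -/
structure RestrictionList (σ : ℕ) where
  α : Fin σ → ℕ
  β : Fin σ → ℕ
  hα : ∀ j, α j ≤ 2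
  hβ : ∀ j, β j ≤ 2

/-- `𝓛`-acceptability: `A_j ≥ α_j` and `B_j ≥ β_j` for every `j`. -/
def Term.LAcc {σ p q : ℕ} (T : Term σ p q) (𝓛 : RestrictionList σ) : Prop :=
  ∀ j, 𝓛.α j ≤ T.A j ∧ 𝓛.β j ≤ T.B j

/-- The order relative to a restriction list:
`d = Σ_j (A_j + B_j - α_j - β_j)`. -/
def Term.orderL {σ p q : ℕ} (T : Term σ p q) (𝓛 : RestrictionList σ) : ℕ :=
  ∑ j, (T.A j - 𝓛.α j + (T.B j - 𝓛.β j))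

/-- A finite linear combination of formal contractions of degree `σ` with
`p` free holomorphic and `q` free anti-holomorphic indices. -/
structure LinComb (σ p q : ℕ) where
  N : ℕ
  coeff : Fin N → ℂ
  term : Fin N → Term σ p q

/-- Evaluation of a linear combination of formal contractions. -/
def LinComb.eval (n : ℕ) {σ p q : ℕ} (L : LinComb σ p q)
    (Ψ : Fin σ → (Fin n → ℂ) → ℝ) (fh : Fin p → Fin n) (fa : Fin q → Fin n)
    (z : Fin n → ℂ) : ℂ :=
  ∑ i, L.coeff i * (L.term i).eval n Ψ fh fa z

open Classical in
/-- Evaluation of the sublinear combination consisting of the terms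
satisfying `P`. -/
def LinComb.evalIf (n : ℕ) {σ p q : ℕ} (L : LinComb σ p q) (P : Fin L.N → Prop)
    (Ψ : Fin σ → (Fin n → ℂ) → ℝ) (fh : Fin p → Fin n) (fa : Fin q → Fin n)
    (z : Fin n → ℂ) : ℂ :=
  ∑ i, if P i then L.coeff i * (L.term i).eval n Ψ fh fa z else 0

/-- The empty assignment of free indices. -/
def noFree {n : ℕ} : Fin 0 → Fin n := fun i => i.elim0

/-- The scalar invariant `L` integrates to zero in dimension `n`. -/
def IntegratesToZero (n : ℕ) {σ : ℕ} (L : LinComb σ 0 0) : Prop :=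
  ∀ Ψ : Fin σ → (Fin n → ℂ) → ℝ, (∀ j, SmoothCpt n (Ψ j)) →
    ∫ z : Fin n → ℂ, L.eval n Ψ noFree noFree z = 0

/-- The scalar invariant `L(φ)` of a single function integrates to zero in
dimension `n`. -/
def IntegratesToZeroPhi (n : ℕ) {σ : ℕ} (L : LinComb σ 0 0) : Prop :=
  ∀ φ : (Fin n → ℂ) → ℝ, SmoothCpt n φ →
    ∫ z : Fin n → ℂ, L.eval n (fun _ => φ) noFree noFree z = 0

/-- The divergence `∂_ā T_a` of a `(1,0)`-form valued invariant. -/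
def divHolo (n : ℕ) {σ : ℕ} (T : LinComb σ 1 0)
    (Ψ : Fin σ → (Fin n → ℂ) → ℝ) (z : Fin n → ℂ) : ℂ :=
  ∑ a : Fin n, dzbar n a (fun w => T.eval n Ψ (fun _ => a) noFree w) z

/-- The divergence `∂_a T_ā` of a `(0,1)`-form valued invariant. -/
def divAnti (n : ℕ) {σ : ℕ} (T : LinComb σ 0 1)
    (Ψ : Fin σ → (Fin n → ℂ) → ℝ) (z : Fin n → ℂ) : ℂ :=
  ∑ a : Fin n, dz n a (fun w => T.eval n Ψ noFree (fun _ => a) w) z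

/-- Two formal contractions are formally equal if their index pairings can be
made to coincide by permuting the (barred, resp. unbarred) index slots on each
factor. -/
def FormallyEq {σ p q : ℕ} (T T' : Term σ p q) : Prop :=
  ∃ (e : T.HoloIdx ≃ T'.HoloIdx) (f : T.AntiIdx ≃ T'.AntiIdx),
    (∀ s : T.HoloIdx, (e s).1 = s.1) ∧ (∀ t : T.AntiIdx, (f t).1 = t.1) ∧
    ∀ x : T.HoloIdx ⊕ Fin q,
      T'.pair (Sum.map (fun s => e s) id x) = Sum.map (fun t => f t) id (T.pair x)

open Classical in
/-- A linear combination of formal contractions vanishes formally: after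
grouping formally equal contractions, all coefficients cancel. -/
def VanishesFormally {σ p q : ℕ} (L : LinComb σ p q) : Prop :=
  ∀ T₀ : Term σ p q,
    (∑ i : Fin L.N, if FormallyEq (L.term i) T₀ then L.coeff i else 0) = 0

/-- `T'` arises from `T` by erasing all the contracted pairs joining the
factors `u` and `v`. -/
def ErasesLinks {σ : ℕ} (u v : Fin σ) (T T' : Term σ 0 0) : Prop :=
  ∃ (e : T'.HoloIdx ↪ T.HoloIdx) (f : T'.AntiIdx ↪ T.AntiIdx),
    (∀ s, (e s).1 = s.1) ∧ (∀ t, (f t).1 = t.1) ∧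
    (∀ (s : T'.HoloIdx) (t : T'.AntiIdx),
      T'.pair (Sum.inl s) = Sum.inl t ↔ T.pair (Sum.inl (e s)) = Sum.inl (f t)) ∧
    (∀ s : T.HoloIdx, s ∉ Set.range e ↔
      ∃ t : T.AntiIdx, T.pair (Sum.inl s) = Sum.inl t ∧
        ((s.1 = u ∧ t.1 = v) ∨ (s.1 = v ∧ t.1 = u))) ∧
    (∀ t : T.AntiIdx, t ∉ Set.range f ↔
      ∃ s : T.HoloIdx, T.pair (Sum.inl s) = Sum.inl t ∧
        ((s.1 = u ∧ t.1 = v) ∨ (s.1 = v ∧ t.1 = u)))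

/-- The mixed fourth derivative `φ_{a c b̄ ē}` of a real function on `ℂⁿ`. -/
def phi4 (n : ℕ) (a c e₁ e₂ : Fin n) (φ : (Fin n → ℂ) → ℝ) : (Fin n → ℂ) → ℂ :=
  dz n a (dz n c (dzbar n e₁ (dzbar n e₂ (fun w => (φ w : ℂ)))))

/-- The `k`-Chern polynomial `I_{k_1,…,k_m}(φ) = (1/k!) contr(ch_{k_1,…,k_m}(φ))`
attached to the partition `k = k 0 + ⋯ + k (m-1)`.  Explicitly, writing the
total index set as `Σ j, Fin (k j)` and letting the cyclic rotation act within
each block, it equals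
`Σ_{a,b} Σ_{π} sgn(π) ∏_s φ_{a_s b_s ā_{rot s} b̄_{π s}}`. -/
def chernPoly (n m : ℕ) (k : Fin m → ℕ) (φ : (Fin n → ℂ) → ℝ)
    (z : Fin n → ℂ) : ℂ :=
  ∑ a : (Σ j : Fin m, Fin (k j)) → Fin n,
    ∑ b : (Σ j : Fin m, Fin (k j)) → Fin n,
      ∑ π : Equiv.Perm (Σ j : Fin m, Fin (k j)),
        ((Equiv.Perm.sign π : ℤ) : ℂ) *
          ∏ s : Σ j : Fin m, Fin (k j),
            phi4 n (a s) (b s) (a ⟨s.1, finRotate (k s.1) s.2⟩) (b (π s)) φ z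

/-- The term of maximum height `Δφ_{a_1 ā_2} Δφ_{a_2 ā_3} ⋯ Δφ_{a_k ā_1}`. -/
def maxHeightTerm (n k : ℕ) (φ : (Fin n → ℂ) → ℝ) (z : Fin n → ℂ) : ℂ :=
  ∑ a : Fin k → Fin n,
    ∏ i : Fin k, ∑ b : Fin n, phi4 n (a i) b (a (finRotate k i)) b φ z


/-- The Wirtinger derivatives, holomorphic on the left and anti-holomorphic on the right. -/
def wirt {n : ℕ} (x : Fin n ⊕ Fin n) (f : (Fin n → ℂ) → ℂ) : (Fin n → ℂ) → ℂ :=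
  Sum.elim (fun a => dz n a f) (fun a => dzbar n a f) x

lemma wirt_eq_fderiv {n : ℕ} (x : Fin n ⊕ Fin n) :
    ∃ (c₁ c₂ : ℂ) (u₁ u₂ : Fin n → ℂ), ∀ f : (Fin n → ℂ) → ℂ,
      wirt x f = fun z => c₁ * fderiv ℝ f z u₁ + c₂ * fderiv ℝ f z u₂ := by
  rcases x with a | a
  · refine ⟨1 / 2, -(1 / 2 * Complex.I), Pi.single a 1, Pi.single a Complex.I, fun f => ?_⟩
    funext z
    simp only [wirt, Sum.elim_inl, dz]
    ring
  · refine ⟨1 / 2, 1 / 2 * Complex.I, Pi.single a 1, Pi.single a Complex.I, fun f => ?_⟩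
    funext z
    simp only [wirt, Sum.elim_inr, dzbar]
    ring

lemma contDiff_fderiv_apply_const {n : ℕ} {f : (Fin n → ℂ) → ℂ} (hf : ContDiff ℝ (⊤ : ℕ∞) f)
    (u : Fin n → ℂ) : ContDiff ℝ (⊤ : ℕ∞) (fun z => fderiv ℝ f z u) :=
  (hf.fderiv_right (m := (⊤ : ℕ∞)) (by simp)).clm_apply contDiff_const

lemma contDiff_wirt {n : ℕ} (x : Fin n ⊕ Fin n) {f : (Fin n → ℂ) → ℂ}
    (hf : ContDiff ℝ (⊤ : ℕ∞) f) : ContDiff ℝ (⊤ : ℕ∞) (wirt x f) := by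
  obtain ⟨c₁, c₂, u₁, u₂, h⟩ := wirt_eq_fderiv x
  rw [h f]
  exact (contDiff_const.mul (contDiff_fderiv_apply_const hf u₁)).add
    (contDiff_const.mul (contDiff_fderiv_apply_const hf u₂))

lemma fderiv_fderiv_comm {n : ℕ} {f : (Fin n → ℂ) → ℂ} (hf : ContDiff ℝ (⊤ : ℕ∞) f)
    (u w z : Fin n → ℂ) :
    fderiv ℝ (fun y => fderiv ℝ f y u) z w = fderiv ℝ (fun y => fderiv ℝ f y w) z u := by
  have hd : DifferentiableAt ℝ (fderiv ℝ f) z :=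
    (hf.fderiv_right (m := (⊤ : ℕ∞)) (by simp)).differentiable (by simp) z
  have key : ∀ u w, fderiv ℝ (fun y => fderiv ℝ f y u) z w = fderiv ℝ (fderiv ℝ f) z w u := by
    intro u w
    rw [fderiv_clm_apply hd (differentiableAt_const u)]
    simp
  have hs : IsSymmSndFDerivAt ℝ f z := by
    apply hf.contDiffAt.isSymmSndFDerivAt
    rw [minSmoothness_of_isRCLikeNormedField]
    exact WithTop.coe_le_coe.mpr le_top
  rw [key, key, hs.eq]

lemma wirt_comm {n : ℕ} (x y : Fin n ⊕ Fin n) {f : (Fin n → ℂ) → ℂ}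
    (hf : ContDiff ℝ (⊤ : ℕ∞) f) : wirt x (wirt y f) = wirt y (wirt x f) := by
  obtain ⟨c₁, c₂, u₁, u₂, hx⟩ := wirt_eq_fderiv x
  obtain ⟨d₁, d₂, w₁, w₂, hy⟩ := wirt_eq_fderiv y
  have hd : ∀ u z, DifferentiableAt ℝ (fun z => fderiv ℝ f z u) z := fun u z =>
    (contDiff_fderiv_apply_const hf u).differentiable (by simp) z
  have key : ∀ (b₁ b₂ : ℂ) (w₁ w₂ z u : Fin n → ℂ),
      fderiv ℝ (fun z => b₁ * fderiv ℝ f z w₁ + b₂ * fderiv ℝ f z w₂) z u =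
        b₁ * fderiv ℝ (fun z => fderiv ℝ f z w₁) z u +
          b₂ * fderiv ℝ (fun z => fderiv ℝ f z w₂) z u := by
    intro b₁ b₂ w₁ w₂ z u
    rw [fderiv_fun_add ((hd w₁ z).const_mul b₁) ((hd w₂ z).const_mul b₂),
      fderiv_const_mul (hd w₁ z), fderiv_const_mul (hd w₂ z)]
    simp
  funext z
  simp only [hx, hy, key]
  rw [fderiv_fderiv_comm hf w₁ u₁, fderiv_fderiv_comm hf w₁ u₂, fderiv_fderiv_comm hf w₂ u₁,
    fderiv_fderiv_comm hf w₂ u₂]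
  ring

lemma wirt_sum {n : ℕ} {ι : Type*} (s : Finset ι) (x : Fin n ⊕ Fin n)
    {f : ι → (Fin n → ℂ) → ℂ} (c : ι → ℂ) (hf : ∀ i ∈ s, ContDiff ℝ (⊤ : ℕ∞) (f i))
    (z : Fin n → ℂ) :
    wirt x (fun w => ∑ i ∈ s, c i * f i w) z = ∑ i ∈ s, c i * wirt x (f i) z := by
  obtain ⟨c₁, c₂, u₁, u₂, hx⟩ := wirt_eq_fderiv x
  have hd : ∀ i ∈ s, DifferentiableAt ℝ (f i) z := fun i hi =>
    (hf i hi).differentiable (by simp) z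
  simp only [hx]
  rw [fderiv_fun_sum fun i hi => (hd i hi).const_mul (c i)]
  simp only [sum_apply, Finset.mul_sum, ← Finset.sum_add_distrib]
  refine Finset.sum_congr rfl fun i hi => ?_
  rw [fderiv_const_mul (hd i hi)]
  simp only [smul_apply, smul_eq_mul]
  ring

lemma wirt_prod {n : ℕ} {ι : Type*} [Fintype ι] [DecidableEq ι] (x : Fin n ⊕ Fin n)
    {f : ι → (Fin n → ℂ) → ℂ} (hf : ∀ i, ContDiff ℝ (⊤ : ℕ∞) (f i)) (z : Fin n → ℂ) :
    wirt x (fun w => ∏ i, f i w) z =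
      ∑ i, ∏ j, if j = i then wirt x (f j) z else f j z := by
  obtain ⟨c₁, c₂, u₁, u₂, hx⟩ := wirt_eq_fderiv x
  have hd : ∀ i ∈ Finset.univ, HasFDerivAt (f i) (fderiv ℝ (f i) z) z := fun i _ =>
    ((hf i).differentiable (by simp) z).hasFDerivAt
  have hprod : ∀ i, (∏ j, if j = i then wirt x (f j) z else f j z) =
      wirt x (f i) z * ∏ j ∈ Finset.univ.erase i, f j z := by
    intro i
    rw [← Finset.mul_prod_erase Finset.univ _ (Finset.mem_univ i), if_pos rfl]
    congr 1
    exact Finset.prod_congr rfl fun j hj => if_neg (Finset.ne_of_mem_erase hj)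
  simp only [hprod]
  simp only [hx]
  rw [(HasFDerivAt.finsetProd hd).fderiv]
  simp only [sum_apply, Finset.mul_sum, ← Finset.sum_add_distrib]
  refine Finset.sum_congr rfl fun i _ => ?_
  simp only [smul_apply, smul_eq_mul]
  ring

/-- Smooth complex-valued functions on `ℂⁿ`. -/
abbrev Smooth (n : ℕ) : Type := {f : (Fin n → ℂ) → ℂ // ContDiff ℝ (⊤ : ℕ∞) f}

/-- The Wirtinger derivatives acting on smooth functions. -/
def Smooth.deriv {n : ℕ} (x : Fin n ⊕ Fin n) (f : Smooth n) : Smooth n :=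
  ⟨wirt x f.1, contDiff_wirt x f.2⟩

instance {n : ℕ} : LeftCommutative (Smooth.deriv (n := n)) :=
  ⟨fun x y f => Subtype.ext (wirt_comm x y f.2)⟩

/-- The iterated Wirtinger derivative along a multiset of indices. -/
def Smooth.iterDeriv {n : ℕ} (f : Smooth n) (s : Multiset (Fin n ⊕ Fin n)) : Smooth n :=
  s.foldr Smooth.deriv f

lemma mixedDeriv_eq_iterDeriv {n A B : ℕ} (hs : Fin A → Fin n) (as : Fin B → Fin n)
    (f : Smooth n) :
    mixedDeriv n hs as f.1 =
      (f.iterDeriv (Finset.univ.val.map (fun s => Sum.inl (hs s)) +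
        Finset.univ.val.map (fun t => Sum.inr (as t)))).1 := by
  have hanti : ∀ (l : List (Fin n)) (g : Smooth n),
      l.foldr (fun a g => dzbar n a g) g.1 =
        (Multiset.foldr Smooth.deriv g (((l.map Sum.inr : List (Fin n ⊕ Fin n))) :
          Multiset (Fin n ⊕ Fin n))).1 := by
    intro l g
    induction l with
    | nil => rfl
    | cons a l ih => simp only [List.foldr_cons, ih]; rfl
  have hholo : ∀ (l : List (Fin n)) (g : Smooth n),
      l.foldr (fun a g => dz n a g) g.1 =
        (Multiset.foldr Smooth.deriv g (((l.map Sum.inl : List (Fin n ⊕ Fin n))) :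
          Multiset (Fin n ⊕ Fin n))).1 := by
    intro l g
    induction l with
    | nil => rfl
    | cons a l ih => simp only [List.foldr_cons, ih]; rfl
  rw [mixedDeriv, hanti, hholo, Smooth.iterDeriv, Multiset.foldr_add]
  simp only [Fin.univ_val_map, List.map_ofFn]
  rfl

section Edges

variable {σ p q n : ℕ} {K : Type}

/-- `T` is the formal contraction with edges `K` and ends `h`, `t`. -/
def HasEnds (T : Term σ p q) (h : K → Fin σ ⊕ Fin q) (t : K → Fin σ ⊕ Fin p) : Prop :=
  ∃ e : K ≃ T.HoloIdx ⊕ Fin q, (∀ k, Sum.map Sigma.fst id (e k) = h k) ∧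
    ∀ k, Sum.map Sigma.fst id (T.pair (e k)) = t k

namespace HasEnds

variable {T : Term σ p q} {h : K → Fin σ ⊕ Fin q} {t : K → Fin σ ⊕ Fin p}

lemma noTraces_iff (H : HasEnds T h t) :
    T.NoTraces ↔ ∀ k j, h k = Sum.inl j → t k ≠ Sum.inl j := by
  obtain ⟨e, hh, ht⟩ := H
  constructor
  · intro hT k j hk hk'
    rw [← hh] at hk
    rw [← ht] at hk'
    rcases hs : e k with s | i <;> rw [hs] at hk hk'
    · rcases hs' : T.pair (Sum.inl s) with s' | i <;> rw [hs'] at hk'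
      · refine hT s s' hs' ?_
        simp only [Sum.map_inl, Sum.inl.injEq] at hk hk'
        rw [hk, hk']
      · simp at hk'
    · simp at hk
  · intro hT s s' hs hss
    refine hT (e.symm (Sum.inl s)) s.1 ?_ ?_
    · simp [← hh]
    · simp [← ht, hs, hss]

lemma freeNotIn (H : HasEnds T h t) {i : Fin σ}
    (hh : ∀ k l, t k = Sum.inr l → h k ≠ Sum.inl i)
    (ht : ∀ k l, h k = Sum.inr l → t k ≠ Sum.inl i) : T.FreeNotIn i := by
  obtain ⟨e, heh, het⟩ := H
  constructor
  · rintro s ⟨l, hl⟩ rfl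
    refine hh (e.symm (Sum.inl s)) l ?_ ?_
    · simp [← het, hl]
    · simp [← heh]
  · rintro s ⟨l, hl⟩ rfl
    refine ht (e.symm (T.pair.symm (Sum.inl s))) l ?_ ?_
    · simp [← heh, hl]
    · simp [← het]

end HasEnds

lemma update_eq_inr_iff [DecidableEq K] (t : K → Fin σ) (k₀ k : K) (i : Fin 1) :
    (Function.update (fun k => Sum.inl (t k)) k₀ (Sum.inr 0) : K → Fin σ ⊕ Fin 1) k = Sum.inr i ↔
      k = k₀ := by
  by_cases hk : k = k₀
  · simp [hk, Subsingleton.elim i 0]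
  · simp [hk]

variable [Fintype K]

/-- The indices of the edges `k` whose end `x k` lies on the factor `j`, where `v` assigns an
index to each edge and `c` records the type of derivative. -/
def endDerivs (x : K → Fin σ ⊕ Fin q) (c : Fin n → Fin n ⊕ Fin n) (v : K → Fin n)
    (j : Fin σ) : Multiset (Fin n ⊕ Fin n) :=
  (Finset.univ.filter fun k => x k = Sum.inl j).val.map fun k => c (v k)

lemma map_fiber_eq {β : Type*} {A : Fin σ → ℕ} (e : K ≃ (Σ j : Fin σ, Fin (A j)) ⊕ Fin q)
    {x : K → Fin σ ⊕ Fin q} (hx : ∀ k, Sum.map Sigma.fst id (e k) = x k) (w : K → β)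
    (j : Fin σ) :
    (Finset.univ : Finset (Fin (A j))).val.map (fun s => w (e.symm (Sum.inl ⟨j, s⟩))) =
      (Finset.univ.filter fun k => x k = Sum.inl j).val.map w := by
  have hinj : Function.Injective fun s : Fin (A j) => e.symm (Sum.inl ⟨j, s⟩) := by
    intro s s' hs
    simpa using hs
  have : (Finset.univ.filter fun k => x k = Sum.inl j) = Finset.univ.map ⟨_, hinj⟩ := by
    ext k
    simp only [Finset.mem_filter, Finset.mem_univ, true_and, Finset.mem_map,
      Function.Embedding.coeFn_mk, ← hx, Equiv.symm_apply_eq]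
    constructor
    · intro hk
      rcases hek : e k with ⟨i, s⟩ | i
      · rw [hek] at hk
        obtain rfl : i = j := by simpa using hk
        exact ⟨s, rfl⟩
      · rw [hek] at hk
        simp at hk
    · rintro ⟨s, hs⟩
      rw [← hs]
      rfl
  rw [this, Finset.map_val, Multiset.map_map]
  rfl

namespace HasEnds

variable {T : Term σ p q} {h : K → Fin σ ⊕ Fin q} {t : K → Fin σ ⊕ Fin p}

lemma card_holo (H : HasEnds T h t) (j : Fin σ) :
    T.A j = (Finset.univ.filter fun k => h k = Sum.inl j).card := by
  obtain ⟨e, he, -⟩ := H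
  simpa only [Multiset.card_map, Finset.card_val, Finset.card_univ, Fintype.card_fin] using
    congrArg Multiset.card (map_fiber_eq e he id j)

lemma card_anti (H : HasEnds T h t) (j : Fin σ) :
    T.B j = (Finset.univ.filter fun k => t k = Sum.inl j).card := by
  obtain ⟨e, -, he⟩ := H
  simpa only [Multiset.card_map, Finset.card_val, Finset.card_univ, Fintype.card_fin] using
    congrArg Multiset.card (map_fiber_eq (e.trans T.pair) he id j)

lemma specialCount_eq (H : HasEnds T h t) (i j : Fin σ) :
    T.specialCount i j =
      (Finset.univ.filter fun k => h k = Sum.inl j ∧ t k = Sum.inl i).card := by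
  obtain ⟨e, hh, ht⟩ := H
  rw [Term.specialCount]
  refine Finset.card_bij (fun s _ => e.symm (Sum.inl s)) ?_ ?_ ?_
  · intro s hs
    simp only [Finset.mem_filter, Finset.mem_univ, true_and] at hs ⊢
    obtain ⟨hj, s', hs', hi⟩ := hs
    simp [← hh, ← ht, hs', hj, hi]
  · intro s _ s' _ hss
    simpa using hss
  · intro k hk
    simp only [Finset.mem_filter, Finset.mem_univ, true_and, ← hh, ← ht] at hk
    rcases hs : e k with s | l <;> rw [hs] at hk
    · refine ⟨s, ?_, by simp [← hs]⟩
      rcases hs' : T.pair (Sum.inl s) with s' | l <;> rw [hs'] at hk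
      · simp only [Sum.map_inl, Sum.inl.injEq] at hk
        simpa only [Finset.mem_filter, Finset.mem_univ, true_and, hs', Sum.inl.injEq,
          exists_eq_left'] using hk
      · simp at hk
    · simp at hk

end HasEnds

lemma exists_slots (x : K → Fin σ ⊕ Fin q) (hx : ∀ i, ∃! k, x k = Sum.inr i) :
    ∃ (A : Fin σ → ℕ) (e : K ≃ (Σ j : Fin σ, Fin (A j)) ⊕ Fin q),
      ∀ k, Sum.map Sigma.fst id (e k) = x k := by
  choose g hg hg' using hx
  let _ : ∀ i, Unique {k // x k = Sum.inr i} := fun i =>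
    ⟨⟨⟨g i, hg i⟩⟩, fun k => Subtype.ext (hg' i k.1 k.2)⟩
  let e' : (Σ y, {k // x k = y}) ≃
      (Σ j : Fin σ, Fin (Fintype.card {k // x k = Sum.inl j})) ⊕ Fin q :=
    (Equiv.sumSigmaDistrib fun y => {k // x k = y}).trans
      (Equiv.sumCongr (Equiv.sigmaCongrRight fun _ => Fintype.equivFin _)
        (Equiv.sigmaUnique _ _))
  have he' : ∀ y, Sum.map Sigma.fst id (e' y) = y.1 := by
    rintro ⟨j | i, k⟩ <;> rfl
  exact ⟨_, (Equiv.sigmaFiberEquiv x).symm.trans e', fun k => he' _⟩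

lemma exists_hasEnds (h : K → Fin σ ⊕ Fin q) (t : K → Fin σ ⊕ Fin p)
    (hh : ∀ i, ∃! k, h k = Sum.inr i) (ht : ∀ i, ∃! k, t k = Sum.inr i)
    (hht : ∀ k i l, h k = Sum.inr i → t k ≠ Sum.inr l) : ∃ T : Term σ p q, HasEnds T h t := by
  obtain ⟨A, e, he⟩ := exists_slots h hh
  obtain ⟨B, f, hf⟩ := exists_slots t ht
  have key : ∀ k i l, e k = Sum.inr i → f k ≠ Sum.inr l := by
    intro k i l hk hl
    exact hht k i l (by simp [← he, hk]) (by simp [← hf, hl])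
  refine ⟨⟨A, B, e.symm.trans f, fun i => ?_, fun i => ?_⟩, e, he, fun k => ?_⟩
  · rcases hs : f (e.symm (Sum.inr i)) with s | l
    · simp [hs]
    · exact absurd hs (key _ i l (by simp))
  · rcases hs : e (f.symm (Sum.inr i)) with s | l
    · simp [hs]
    · exact absurd (by simp) (key _ l i hs)
  · simpa using hf k

lemma HasEnds.lAcc {T : Term σ p q} {h : K → Fin σ ⊕ Fin q} {t : K → Fin σ ⊕ Fin p}
    (H : HasEnds T h t) {𝓛 : RestrictionList σ}
    (hh : ∀ j, 𝓛.α j ≤ (Finset.univ.filter fun k => h k = Sum.inl j).card)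
    (ht : ∀ j, 𝓛.β j ≤ (Finset.univ.filter fun k => t k = Sum.inl j).card) : T.LAcc 𝓛 :=
  fun j => ⟨H.card_holo j ▸ hh j, H.card_anti j ▸ ht j⟩

lemma le_card_fiber_of_eq_off [DecidableEq K] {t : K → Fin σ} {x : K → Fin σ ⊕ Fin q} {k₀ : K}
    (hx : ∀ k, k ≠ k₀ → x k = Sum.inl (t k)) {b : Fin σ → ℕ}
    (hb : ∀ j, b j ≤ (Finset.univ.filter fun k => t k = j).card)
    (hb₀ : b (t k₀) < (Finset.univ.filter fun k => t k = t k₀).card) (j : Fin σ) :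
    b j ≤ (Finset.univ.filter fun k => x k = Sum.inl j).card := by
  have hsub : (Finset.univ.filter fun k => t k = j).erase k₀ ⊆
      Finset.univ.filter fun k => x k = Sum.inl j := by
    intro k hk
    simp only [Finset.mem_erase, Finset.mem_filter, Finset.mem_univ, true_and] at hk ⊢
    rw [hx k hk.1, hk.2]
  refine le_trans ?_ (Finset.card_le_card hsub)
  by_cases hj : t k₀ = j
  · subst hj
    rw [Finset.card_erase_of_mem (by simp)]
    omega
  · rw [Finset.erase_eq_of_notMem (by simpa using hj)]
    exact hb j

lemma endDerivs_update [DecidableEq K] (t : K → Fin σ) (k₀ : K) (i : Fin σ)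
    (c : Fin n → Fin n ⊕ Fin n) (v : K → Fin n) (j : Fin σ) :
    endDerivs (fun k => (Sum.inl (Function.update t k₀ i k) : Fin σ ⊕ Fin 0)) c v j =
      endDerivs (Function.update (fun k => Sum.inl (t k)) k₀ (Sum.inr 0) : K → Fin σ ⊕ Fin 1) c v j
        + if j = i then {c (v k₀)} else 0 := by
  set S := Finset.univ.filter fun k =>
    (Function.update (fun k => Sum.inl (t k)) k₀ (Sum.inr 0) : K → Fin σ ⊕ Fin 1) k = Sum.inl j
    with hS
  have hk₀ : k₀ ∉ S := by simp [hS]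
  rw [endDerivs, endDerivs, ← hS]
  split_ifs with hj
  · have : (Finset.univ.filter fun k =>
        (Sum.inl (Function.update t k₀ i k) : Fin σ ⊕ Fin 0) = Sum.inl j) = Finset.cons k₀ S hk₀ := by
      ext k
      by_cases hk : k = k₀
      · simp [hk, hj]
      · simp [hk, hS]
    rw [this, Finset.cons_val, Multiset.map_cons, ← Multiset.singleton_add, add_comm]
  · have : (Finset.univ.filter fun k =>
        (Sum.inl (Function.update t k₀ i k) : Fin σ ⊕ Fin 0) = Sum.inl j) = S := by
      ext k
      by_cases hk : k = k₀
      · simp [hk, hS, Ne.symm hj]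
      · simp [hk, hS]
    rw [this, add_zero]

variable [DecidableEq K]

/-- The contraction whose contracted pairs are the edges `k : K`, with holomorphic end `h k` and
anti-holomorphic end `t k`; an end is either a factor or a free label. -/
def edgeEval (h : K → Fin σ ⊕ Fin q) (t : K → Fin σ ⊕ Fin p) (F : Fin σ → Smooth n)
    (fh : Fin p → Fin n) (fa : Fin q → Fin n) (z : Fin n → ℂ) : ℂ :=
  ∑ v : K → Fin n,
    (if (∀ k i, h k = Sum.inr i → v k = fa i) ∧ (∀ k i, t k = Sum.inr i → v k = fh i)
      then (1 : ℂ) else 0) *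
    ∏ j, ((F j).iterDeriv (endDerivs h Sum.inl v j + endDerivs t Sum.inr v j)).1 z

lemma HasEnds.eval_eq {T : Term σ p q} {h : K → Fin σ ⊕ Fin q} {t : K → Fin σ ⊕ Fin p}
    (H : HasEnds T h t) {Ψ : Fin σ → (Fin n → ℂ) → ℝ} {F : Fin σ → Smooth n}
    (hF : ∀ j, (F j).1 = fun w => (Ψ j w : ℂ)) (fh : Fin p → Fin n) (fa : Fin q → Fin n)
    (z : Fin n → ℂ) : T.eval n Ψ fh fa z = edgeEval h t F fh fa z := by
  obtain ⟨e, hh, ht⟩ := H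
  rw [Term.eval, edgeEval]
  refine Fintype.sum_equiv (e.arrowCongr (Equiv.refl _)).symm _ _ fun v => ?_
  congr 1
  · refine if_congr ?_ rfl rfl
    simp only [Equiv.arrowCongr_symm, Equiv.arrowCongr_apply, Equiv.refl_symm, Equiv.coe_refl,
      Equiv.symm_symm, Function.comp_apply, id_eq]
    refine and_congr ⟨?_, ?_⟩ ⟨?_, ?_⟩
    · intro hv k i hk
      rw [← hh] at hk
      rcases hs : e k with s | l <;> rw [hs] at hk
      · simp at hk
      · obtain rfl : l = i := by simpa using hk
        exact hv l
    · intro hv i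
      simpa using hv (e.symm (Sum.inr i)) i (by simp [← hh])
    · intro hv k i hk
      rw [← ht] at hk
      have hk' : T.pair (e k) = Sum.inr i := by
        rcases hs : T.pair (e k) with s | l <;> rw [hs] at hk
        · simp at hk
        · simpa using hk
      have hl := T.okp i
      rw [← hk', Equiv.symm_apply_apply] at hl
      obtain ⟨s, hs⟩ := Sum.isLeft_iff.mp hl
      rw [hs] at hk' ⊢
      exact hv s i hk'
    · intro hv s i hs
      simpa using hv (e.symm (Sum.inl s)) i (by simp [← ht, hs])
  · refine Finset.prod_congr rfl fun j _ => ?_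
    rw [← hF, mixedDeriv_eq_iterDeriv]
    rw [endDerivs, endDerivs, ← map_fiber_eq e hh, ← map_fiber_eq (e.trans T.pair) ht]
    simp only [Equiv.arrowCongr_symm, Equiv.arrowCongr_apply, Equiv.refl_symm, Equiv.coe_refl,
      Equiv.symm_symm, Function.comp_apply, id_eq, Equiv.symm_trans_apply,
      Equiv.apply_symm_apply]

lemma contDiff_prod_iterDeriv (F : Fin σ → Smooth n) (m : Fin σ → Multiset (Fin n ⊕ Fin n)) :
    ContDiff ℝ (⊤ : ℕ∞) fun z => ∏ j, ((F j).iterDeriv (m j)).1 z :=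
  contDiff_prod fun j _ => ((F j).iterDeriv (m j)).2

lemma sum_wirt_edge (c : Fin n → Fin n ⊕ Fin n) (k₀ : K) (F : Fin σ → Smooth n)
    (m : (K → Fin n) → Fin σ → Multiset (Fin n ⊕ Fin n)) (z : Fin n → ℂ) :
    ∑ a, wirt (c a) (fun w => ∑ v : K → Fin n,
        (if v k₀ = a then (1 : ℂ) else 0) * ∏ j, ((F j).iterDeriv (m v j)).1 w) z =
      ∑ i, ∑ v : K → Fin n,
        ∏ j, ((F j).iterDeriv (m v j + if j = i then {c (v k₀)} else 0)).1 z := by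
  simp only [wirt_sum _ _ _ fun v _ => contDiff_prod_iterDeriv F (m v)]
  rw [Finset.sum_comm]
  simp only [ite_mul, one_mul, zero_mul, Finset.sum_ite_eq, Finset.mem_univ, if_true]
  rw [Finset.sum_comm]
  refine Finset.sum_congr rfl fun v _ => ?_
  rw [wirt_prod _ fun j => ((F j).iterDeriv (m v j)).2]
  refine Finset.sum_congr rfl fun i _ => Finset.prod_congr rfl fun j _ => ?_
  split_ifs
  · rw [add_comm, Multiset.singleton_add, Smooth.iterDeriv, Smooth.iterDeriv, Multiset.foldr_cons]
    rfl
  · rw [add_zero]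

lemma edgeEval_inl (h t : K → Fin σ) (F : Fin σ → Smooth n) (fh fa : Fin 0 → Fin n)
    (z : Fin n → ℂ) :
    edgeEval (fun k => Sum.inl (h k)) (fun k => Sum.inl (t k)) F fh fa z =
      ∑ v : K → Fin n, ∏ j, ((F j).iterDeriv
        (endDerivs (fun k => (Sum.inl (h k) : Fin σ ⊕ Fin 0)) Sum.inl v j +
          endDerivs (fun k => (Sum.inl (t k) : Fin σ ⊕ Fin 0)) Sum.inr v j)).1 z := by
  simp [edgeEval]

lemma sum_dzbar_edgeEval (h t : K → Fin σ) (k₀ : K) (F : Fin σ → Smooth n) (z : Fin n → ℂ) :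
    ∑ a, dzbar n a (fun w => edgeEval (fun k => Sum.inl (h k))
        (Function.update (fun k => Sum.inl (t k)) k₀ (Sum.inr 0) : K → Fin σ ⊕ Fin 1) F
        (fun _ => a) noFree w) z =
      ∑ i, edgeEval (fun k => Sum.inl (h k)) (fun k => Sum.inl (Function.update t k₀ i k)) F
        noFree noFree z := by
  simp only [edgeEval_inl, endDerivs_update, ← add_assoc]
  refine Eq.trans ?_ (sum_wirt_edge Sum.inr k₀ F _ z)
  simp [edgeEval, update_eq_inr_iff, wirt]

lemma sum_dz_edgeEval (h t : K → Fin σ) (k₀ : K) (F : Fin σ → Smooth n) (z : Fin n → ℂ) :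
    ∑ a, dz n a (fun w => edgeEval
        (Function.update (fun k => Sum.inl (h k)) k₀ (Sum.inr 0) : K → Fin σ ⊕ Fin 1)
        (fun k => Sum.inl (t k)) F noFree (fun _ => a) w) z =
      ∑ i, edgeEval (fun k => Sum.inl (Function.update h k₀ i k)) (fun k => Sum.inl (t k)) F
        noFree noFree z := by
  simp only [edgeEval_inl, endDerivs_update, add_right_comm _ (ite _ _ _)]
  refine Eq.trans ?_ (sum_wirt_edge Sum.inl k₀ F _ z)
  simp [edgeEval, update_eq_inr_iff, wirt]

end Edges

lemma Term.contDiff_eval {σ p q n : ℕ} (T : Term σ p q) {Ψ : Fin σ → (Fin n → ℂ) → ℝ}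
    (hΨ : ∀ j, SmoothCpt n (Ψ j)) (fh : Fin p → Fin n) (fa : Fin q → Fin n) :
    ContDiff ℝ (⊤ : ℕ∞) fun z => T.eval n Ψ fh fa z := by
  have H : HasEnds T (fun k => Sum.map Sigma.fst id k) (fun k => Sum.map Sigma.fst id (T.pair k)) :=
    ⟨Equiv.refl _, fun _ => rfl, fun _ => rfl⟩
  simp only [H.eval_eq (F := fun j => ⟨fun w => (Ψ j w : ℂ),
    Complex.ofRealCLM.contDiff.comp (hΨ j).1⟩) (fun _ => rfl), edgeEval]
  exact ContDiff.sum fun v _ => contDiff_const.mul (contDiff_prod_iterDeriv _ _)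

/-- The linear combination with coefficients `c` and terms `T`, indexed by a finite type. -/
def LinComb.ofFintype {σ p q : ℕ} {ι : Type*} [Fintype ι] (c : ι → ℂ) (T : ι → Term σ p q) :
    LinComb σ p q where
  N := Fintype.card ι
  coeff r := c ((Fintype.equivFin ι).symm r)
  term r := T ((Fintype.equivFin ι).symm r)

lemma LinComb.forall_term_ofFintype {σ p q : ℕ} {ι : Type*} [Fintype ι] (c : ι → ℂ)
    (T : ι → Term σ p q) {Q : Term σ p q → Prop} (hQ : ∀ i, Q (T i)) :
    ∀ r, Q ((LinComb.ofFintype c T).term r) :=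
  fun _ => hQ _

lemma LinComb.eval_ofFintype {σ p q n : ℕ} {ι : Type*} [Fintype ι] (c : ι → ℂ)
    (T : ι → Term σ p q) (Ψ : Fin σ → (Fin n → ℂ) → ℝ) (fh : Fin p → Fin n) (fa : Fin q → Fin n)
    (z : Fin n → ℂ) :
    (LinComb.ofFintype c T).eval n Ψ fh fa z = ∑ i, c i * (T i).eval n Ψ fh fa z :=
  Equiv.sum_comp (Fintype.equivFin ι).symm fun i => c i * (T i).eval n Ψ fh fa z

open Classical in
lemma LinComb.evalIf_eq_sum_subtype {σ p q n : ℕ} (L : LinComb σ p q) (P : Fin L.N → Prop)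
    [Fintype {r // P r}] (Ψ : Fin σ → (Fin n → ℂ) → ℝ) (fh : Fin p → Fin n) (fa : Fin q → Fin n)
    (z : Fin n → ℂ) :
    L.evalIf n P Ψ fh fa z = ∑ r : {r // P r}, L.coeff r * (L.term r).eval n Ψ fh fa z := by
  rw [LinComb.evalIf, ← Finset.sum_filter]
  exact Finset.sum_subtype _ (by simp) _

lemma divHolo_ofFintype {σ n : ℕ} {ι : Type*} [Fintype ι] (c : ι → ℂ) (T : ι → Term σ 1 0)
    {Ψ : Fin σ → (Fin n → ℂ) → ℝ} (hΨ : ∀ j, SmoothCpt n (Ψ j)) (z : Fin n → ℂ) :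
    divHolo n (LinComb.ofFintype c T) Ψ z =
      ∑ i, c i * ∑ a, dzbar n a (fun w => (T i).eval n Ψ (fun _ => a) noFree w) z := by
  simp only [divHolo, LinComb.eval_ofFintype, Finset.mul_sum]
  rw [Finset.sum_comm]
  exact Finset.sum_congr rfl fun a _ => wirt_sum Finset.univ (Sum.inr a) c
    (fun i _ => (T i).contDiff_eval hΨ (fun _ => a) noFree) z

lemma divAnti_ofFintype {σ n : ℕ} {ι : Type*} [Fintype ι] (c : ι → ℂ) (T : ι → Term σ 0 1)
    {Ψ : Fin σ → (Fin n → ℂ) → ℝ} (hΨ : ∀ j, SmoothCpt n (Ψ j)) (z : Fin n → ℂ) :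
    divAnti n (LinComb.ofFintype c T) Ψ z =
      ∑ i, c i * ∑ a, dz n a (fun w => (T i).eval n Ψ noFree (fun _ => a) w) z := by
  simp only [divAnti, LinComb.eval_ofFintype, Finset.mul_sum]
  rw [Finset.sum_comm]
  exact Finset.sum_congr rfl fun a _ => wirt_sum Finset.univ (Sum.inl a) c
    (fun i _ => (T i).contDiff_eval hΨ noFree (fun _ => a)) z

lemma Term.exists_hasEnds_inl {σ : ℕ} (T : Term σ 0 0) :
    ∃ h t : T.HoloIdx ⊕ Fin 0 → Fin σ,
      HasEnds T (fun k => Sum.inl (h k)) (fun k => Sum.inl (t k)) :=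
  ⟨fun k => Equiv.sumEmpty _ (Fin 0) (Sum.map Sigma.fst id k),
    fun k => Equiv.sumEmpty _ (Fin 0) (Sum.map Sigma.fst id (T.pair k)), Equiv.refl _,
    fun _ => ((Equiv.sumEmpty (Fin σ) (Fin 0)).symm_apply_apply _).symm,
    fun _ => ((Equiv.sumEmpty (Fin σ) (Fin 0)).symm_apply_apply _).symm⟩

/-- Integrating by parts twice across a special contraction of the factors `i` and `l`: first the
anti-holomorphic derivative on the factor `i`, then the holomorphic one on the factor `l`. -/
lemma Term.exists_integrate_by_parts {σ : ℕ} {𝓛 : RestrictionList σ} {i l : Fin σ}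
    (T : Term σ 0 0) (hacc : T.LAcc 𝓛) (htr : T.NoTraces) (hpos : 0 < T.specialCount i l)
    (hα : 𝓛.α l < T.A l) (hβ : 𝓛.β i < T.B i) :
    ∃ (Ta : Term σ 1 0) (Tb : Term σ 0 1) (R : LinComb σ 0 0),
      (Ta.LAcc 𝓛 ∧ Ta.NoTraces ∧ Ta.FreeNotIn i) ∧
      (Tb.LAcc 𝓛 ∧ Tb.NoTraces ∧ Tb.FreeNotIn i) ∧
      (∀ r, (R.term r).LAcc 𝓛 ∧ (R.term r).NoTraces ∧
        (R.term r).specialCount i l < T.specialCount i l) ∧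
      ∀ (n : ℕ) (Ψ : Fin σ → (Fin n → ℂ) → ℝ), (∀ j, SmoothCpt n (Ψ j)) → ∀ z,
        T.eval n Ψ noFree noFree z =
          ∑ a, dzbar n a (fun w => Ta.eval n Ψ (fun _ => a) noFree w) z -
            ∑ a, dz n a (fun w => Tb.eval n Ψ noFree (fun _ => a) w) z +
            R.eval n Ψ noFree noFree z := by
  obtain ⟨h, t, H⟩ := T.exists_hasEnds_inl
  rw [H.specialCount_eq, Finset.card_pos] at hpos
  obtain ⟨k₀, hk₀⟩ := hpos
  obtain ⟨rfl, rfl⟩ : h k₀ = l ∧ t k₀ = i := by simpa using hk₀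
  have hne : ∀ k, t k ≠ h k := fun k hk =>
    H.noTraces_iff.mp htr k (h k) rfl (congrArg Sum.inl hk)
  have hA : ∀ j, T.A j = (Finset.univ.filter fun k => h k = j).card := fun j => by
    simpa only [Sum.inl.injEq] using H.card_holo j
  have hB : ∀ j, T.B j = (Finset.univ.filter fun k => t k = j).card := fun j => by
    simpa only [Sum.inl.injEq] using H.card_anti j
  have hαle : ∀ {q : ℕ} {x : T.HoloIdx ⊕ Fin 0 → Fin σ ⊕ Fin q},
      (∀ k, k ≠ k₀ → x k = Sum.inl (h k)) →
        ∀ j, 𝓛.α j ≤ (Finset.univ.filter fun k => x k = Sum.inl j).card := fun hx =>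
    le_card_fiber_of_eq_off hx (fun j => hA j ▸ (hacc j).1) (hA _ ▸ hα)
  have hβle : ∀ {p : ℕ} {x : T.HoloIdx ⊕ Fin 0 → Fin σ ⊕ Fin p},
      (∀ k, k ≠ k₀ → x k = Sum.inl (t k)) →
        ∀ j, 𝓛.β j ≤ (Finset.univ.filter fun k => x k = Sum.inl j).card := fun hx =>
    le_card_fiber_of_eq_off hx (fun j => hB j ▸ (hacc j).2) (hB _ ▸ hβ)
  have hex : ∀ h' t' : T.HoloIdx ⊕ Fin 0 → Fin σ, ∃ T' : Term σ 0 0,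
      HasEnds T' (fun k => Sum.inl (h' k)) (fun k => Sum.inl (t' k)) := fun h' t' =>
    exists_hasEnds _ _ (fun m => m.elim0) (fun m => m.elim0) fun _ m => m.elim0
  choose S hS using hex
  have hgood : ∀ h' t' : T.HoloIdx ⊕ Fin 0 → Fin σ, (∀ k, k ≠ k₀ → h' k = h k) →
      (∀ k, k ≠ k₀ → t' k = t k) → t' k₀ ≠ h' k₀ → t' k₀ ≠ t k₀ →
      (S h' t').LAcc 𝓛 ∧ (S h' t').NoTraces ∧
        (S h' t').specialCount (t k₀) (h k₀) < T.specialCount (t k₀) (h k₀) := by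
    intro h' t' hh' ht' hne' hsp
    refine ⟨(hS h' t').lAcc (hαle fun k hk => by rw [hh' k hk])
      (hβle fun k hk => by rw [ht' k hk]), (hS h' t').noTraces_iff.mpr ?_, ?_⟩
    · intro k j hk hk'
      obtain rfl := Sum.inl_injective hk
      by_cases hkk : k = k₀
      · exact hne' (hkk ▸ Sum.inl_injective hk')
      · exact hne k (by rw [← hh' k hkk, ← ht' k hkk, Sum.inl_injective hk'])
    · rw [(hS h' t').specialCount_eq, H.specialCount_eq]
      refine Finset.card_lt_card (Finset.ssubset_iff_of_subset ?_ |>.mpr ⟨k₀, by simp, ?_⟩)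
      · intro k hk
        simp only [Finset.mem_filter, Finset.mem_univ, true_and, Sum.inl.injEq] at hk ⊢
        have hkk : k ≠ k₀ := fun hkk => hsp (hkk ▸ hk.2)
        rwa [hh' k hkk, ht' k hkk] at hk
      · simpa using fun _ => hsp
  have huniq : ∀ (x : T.HoloIdx ⊕ Fin 0 → Fin σ) (m : Fin 1), ∃! k,
      (Function.update (fun k => Sum.inl (x k)) k₀ (Sum.inr 0) : _ → Fin σ ⊕ Fin 1) k =
        Sum.inr m := fun x m =>
    ⟨k₀, (update_eq_inr_iff x k₀ k₀ m).mpr rfl, fun k hk => (update_eq_inr_iff x k₀ k m).mp hk⟩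
  obtain ⟨Ta, hTa⟩ := exists_hasEnds (fun k => (Sum.inl (h k) : Fin σ ⊕ Fin 0))
    (Function.update (fun k => Sum.inl (t k)) k₀ (Sum.inr 0) : _ → Fin σ ⊕ Fin 1)
    (fun m => m.elim0) (huniq t) (fun _ m => m.elim0)
  obtain ⟨Tb, hTb⟩ := exists_hasEnds
    (Function.update (fun k => Sum.inl (h k)) k₀ (Sum.inr 0) : _ → Fin σ ⊕ Fin 1)
    (fun k => (Sum.inl (Function.update t k₀ (h k₀) k) : Fin σ ⊕ Fin 0))
    (huniq h) (fun m => m.elim0) (fun _ _ m => m.elim0)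
  refine ⟨Ta, Tb, LinComb.ofFintype
    (ι := {j : {j // j ≠ t k₀} // j ≠ ⟨h k₀, (hne k₀).symm⟩} ⊕ {j // j ≠ h k₀})
    (Sum.elim (fun _ => -1) fun _ => 1)
    (Sum.elim (fun j => S h (Function.update t k₀ j))
      fun j => S (Function.update h k₀ j) (Function.update t k₀ (h k₀))),
    ⟨hTa.lAcc (hαle fun _ _ => rfl) (hβle fun k hk => by simp [hk]),
      hTa.noTraces_iff.mpr ?_, hTa.freeNotIn ?_ ?_⟩,
    ⟨hTb.lAcc (hαle fun k hk => by simp [hk]) (hβle fun k hk => by simp [hk]),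
      hTb.noTraces_iff.mpr ?_, hTb.freeNotIn ?_ ?_⟩, ?_, ?_⟩
  · intro k j hk
    obtain rfl := Sum.inl_injective hk
    by_cases hkk : k = k₀
    · simp [hkk]
    · simpa [hkk] using hne k
  · intro k m hk
    rw [update_eq_inr_iff] at hk
    simpa [hk] using (hne k₀).symm
  · simp
  · intro k j hk
    by_cases hkk : k = k₀
    · simp [hkk] at hk
    · obtain rfl : h k = j := by simpa [hkk] using hk
      simpa [hkk] using hne k
  · simp
  · intro k m hk
    rw [update_eq_inr_iff] at hk
    simpa [hk] using (hne k₀).symm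
  · refine LinComb.forall_term_ofFintype _ _ (Q := fun T' => T'.LAcc 𝓛 ∧ T'.NoTraces ∧
      T'.specialCount (t k₀) (h k₀) < T.specialCount (t k₀) (h k₀)) ?_
    rintro (j | j)
    · have hj : j.1.1 ≠ h k₀ := fun hj => j.2 (Subtype.ext hj)
      exact hgood _ _ (fun _ _ => rfl) (fun k hk => Function.update_of_ne hk _ _)
        (by simpa using hj) (by simpa using j.1.2)
    · exact hgood _ _ (fun k hk => Function.update_of_ne hk _ _)
        (fun k hk => Function.update_of_ne hk _ _) (by simpa using j.2.symm)
        (by simpa using (hne k₀).symm)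
  · intro n Ψ hΨ z
    let F : Fin σ → Smooth n := fun j => ⟨fun w => (Ψ j w : ℂ),
      Complex.ofRealCLM.contDiff.comp (hΨ j).1⟩
    have hF : ∀ j, (F j).1 = fun w => (Ψ j w : ℂ) := fun _ => rfl
    simp only [LinComb.eval_ofFintype, Fintype.sum_sum_type, Sum.elim_inl, Sum.elim_inr,
      H.eval_eq hF, hTa.eval_eq hF, hTb.eval_eq hF, (hS _ _).eval_eq hF, sum_dzbar_edgeEval,
      sum_dz_edgeEval]
    rw [Fintype.sum_eq_add_sum_subtype_ne _ (t k₀),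
      Fintype.sum_eq_add_sum_subtype_ne _ (⟨h k₀, (hne k₀).symm⟩ : {j // j ≠ t k₀}),
      Fintype.sum_eq_add_sum_subtype_ne _ (h k₀)]
    simp only [Function.update_eq_self, neg_mul, one_mul, Finset.sum_neg_distrib]
    ring

/-- Lemma 3.9: with no traces in any term, if every term with
the maximal number `M` of special contractions `Ψ^1_ā Ψ^σ_a` satisfies
`A_σ > α_σ` and `B_1 > β_1`, then that sublinear combination equals a
divergence (trace-free, free index away from the factor on `ψ^1`) plus a
trace-free linear combination with at most `M - 1` special contractions. -/
theorem decr_special_nonminimal {σ n : ℕ} (hσ : 0 < σ)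
    (𝓛 : RestrictionList σ) (L : LinComb σ 0 0)
    (hacc : ∀ r, (L.term r).LAcc 𝓛)
    (htr : ∀ r, (L.term r).NoTraces)
    (M : ℕ)
    (hM : ∀ r, (L.term r).specialCount ⟨0, hσ⟩ ⟨σ - 1, by omega⟩ ≤ M)
    (hach : ∃ r, (L.term r).specialCount ⟨0, hσ⟩ ⟨σ - 1, by omega⟩ = M)
    (hnonmin : ∀ r, (L.term r).specialCount ⟨0, hσ⟩ ⟨σ - 1, by omega⟩ = M →
      𝓛.α ⟨σ - 1, by omega⟩ < (L.term r).A ⟨σ - 1, by omega⟩ ∧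
      𝓛.β ⟨0, hσ⟩ < (L.term r).B ⟨0, hσ⟩) :
    ∃ (Ta : LinComb σ 1 0) (Tb : LinComb σ 0 1) (LM : LinComb σ 0 0),
      (∀ r, (Ta.term r).LAcc 𝓛) ∧ (∀ r, (Tb.term r).LAcc 𝓛) ∧
      (∀ r, (Ta.term r).NoTraces) ∧ (∀ r, (Tb.term r).NoTraces) ∧
      (∀ r, (Ta.term r).FreeNotIn ⟨0, hσ⟩) ∧
      (∀ r, (Tb.term r).FreeNotIn ⟨0, hσ⟩) ∧
      (∀ r, (LM.term r).LAcc 𝓛) ∧ (∀ r, (LM.term r).NoTraces) ∧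
      (∀ r, (LM.term r).specialCount ⟨0, hσ⟩ ⟨σ - 1, by omega⟩ ≤ M - 1) ∧
      ∀ Ψ : Fin σ → (Fin n → ℂ) → ℝ, (∀ j, SmoothCpt n (Ψ j)) → ∀ z,
        L.evalIf n
            (fun r => (L.term r).specialCount ⟨0, hσ⟩ ⟨σ - 1, by omega⟩ = M)
            Ψ noFree noFree z =
          divHolo n Ta Ψ z + divAnti n Tb Ψ z +
            LM.eval n Ψ noFree noFree z := by
  classical
  let P : Fin L.N → Prop := fun r => (L.term r).specialCount ⟨0, hσ⟩ ⟨σ - 1, by omega⟩ = M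
  rcases Nat.eq_zero_or_pos M with hM₀ | hM₀
  · refine ⟨⟨0, Fin.elim0, Fin.elim0⟩, ⟨0, Fin.elim0, Fin.elim0⟩,
      LinComb.ofFintype (fun r : {r // P r} => L.coeff r) (fun r => L.term r),
      fun r => r.elim0, fun r => r.elim0, fun r => r.elim0, fun r => r.elim0,
      fun r => r.elim0, fun r => r.elim0, fun r => hacc _, fun r => htr _,
      fun r => (hM _).trans (by omega), fun Ψ _ z => ?_⟩
    rw [L.evalIf_eq_sum_subtype P, LinComb.eval_ofFintype]
    simp [divHolo, divAnti, LinComb.eval, dz, dzbar]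
  · have hstep := fun r : {r // P r} => (L.term r).exists_integrate_by_parts (hacc r) (htr r)
      (hM₀.trans_eq r.2.symm) (hnonmin r r.2).1 (hnonmin r r.2).2
    choose Ta Tb R hTa hTb hR heval using hstep
    refine ⟨LinComb.ofFintype (fun r : {r // P r} => L.coeff r) Ta,
      LinComb.ofFintype (fun r : {r // P r} => -L.coeff r) Tb,
      LinComb.ofFintype (fun x : Σ r : {r // P r}, Fin (R r).N => L.coeff x.1 * (R x.1).coeff x.2)
        (fun x => (R x.1).term x.2),
      fun r => (hTa _).1, fun r => (hTb _).1, fun r => (hTa _).2.1, fun r => (hTb _).2.1,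
      fun r => (hTa _).2.2, fun r => (hTb _).2.2, fun r => (hR _ _).1, fun r => (hR _ _).2.1,
      fun r => Nat.le_sub_one_of_lt ((hR _ _).2.2.trans_le (hM _)), fun Ψ hΨ z => ?_⟩
    rw [L.evalIf_eq_sum_subtype P, divHolo_ofFintype _ _ hΨ, divAnti_ofFintype _ _ hΨ, LinComb.eval_ofFintype,
      Fintype.sum_sigma, ← Finset.sum_add_distrib, ← Finset.sum_add_distrib]
    refine Finset.sum_congr rfl fun r _ => ?_
    rw [heval r n Ψ hΨ z, LinComb.eval]
    simp only [mul_assoc, ← Finset.mul_sum]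
    ring

end KahlerInv
end
end

section
/- For every integer m ≥ 1, every partition k = k_1 + … + k_m with each k_j ≥ 1, every n ≥ 1, and every φ ∈ C_c^∞(ℂ^n, ℝ), the k-Chern polynomial of φ integrates to zero: ∫_{ℂ^n} I_{k_1,…,k_m}(φ) dV = 0, where dV is the Lebesgue measure on ℂ^n = ℝ^{2n}. -/
open MeasureTheory

noncomputable section

namespace KahlerInv

/-- Wirtinger derivatives preserve smoothness. -/
lemma contDiff_dz {n : ℕ} {f : (Fin n → ℂ) → ℂ} (hf : ContDiff ℝ (⊤ : ℕ∞) f) (a : Fin n) :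
    ContDiff ℝ (⊤ : ℕ∞) (dz n a f) := by
  have h : ∀ v, ContDiff ℝ (⊤ : ℕ∞) fun z => fderiv ℝ f z v := fun v =>
    (hf.fderiv_right (by simp)).clm_apply contDiff_const
  exact contDiff_const.mul ((h _).sub (contDiff_const.mul (h _)))

lemma contDiff_dzbar {n : ℕ} {f : (Fin n → ℂ) → ℂ} (hf : ContDiff ℝ (⊤ : ℕ∞) f) (a : Fin n) :
    ContDiff ℝ (⊤ : ℕ∞) (dzbar n a f) := by
  have h : ∀ v, ContDiff ℝ (⊤ : ℕ∞) fun z => fderiv ℝ f z v := fun v =>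
    (hf.fderiv_right (by simp)).clm_apply contDiff_const
  exact contDiff_const.mul ((h _).add (contDiff_const.mul (h _)))

/-- Wirtinger derivatives preserve compactness of the support. -/
lemma hasCompactSupport_dz {n : ℕ} {f : (Fin n → ℂ) → ℂ} (hf : HasCompactSupport f) (a : Fin n) :
    HasCompactSupport (dz n a f) := by
  refine (hf.fderiv ℝ).mono fun z hz => ?_
  contrapose! hz
  simp_all [dz]

lemma hasCompactSupport_dzbar {n : ℕ} {f : (Fin n → ℂ) → ℂ} (hf : HasCompactSupport f)
    (a : Fin n) : HasCompactSupport (dzbar n a f) := by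
  refine (hf.fderiv ℝ).mono fun z hz => ?_
  contrapose! hz
  simp_all [dzbar]

/-- Holomorphic Wirtinger derivatives of a smooth function commute. -/
lemma dz_comm {n : ℕ} {f : (Fin n → ℂ) → ℂ} (hf : ContDiff ℝ (⊤ : ℕ∞) f) (a b : Fin n) :
    dz n a (dz n b f) = dz n b (dz n a f) := by
  funext z
  have hd : DifferentiableAt ℝ (fderiv ℝ f) z :=
    (hf.fderiv_right (m := (⊤ : ℕ∞)) (by simp)).differentiable (by simp) z
  have key : ∀ (c : Fin n) u, fderiv ℝ (dz n c f) z u = (1 / 2 : ℂ) *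
      (fderiv ℝ (fderiv ℝ f) z u (Pi.single c 1) -
        Complex.I * fderiv ℝ (fderiv ℝ f) z u (Pi.single c Complex.I)) := by
    intro c u
    have h : ∀ v, HasFDerivAt (fun w => fderiv ℝ f w v)
        ((fderiv ℝ (fderiv ℝ f) z).flip v) z := fun v => by
      simpa using hd.hasFDerivAt.clm_apply (hasFDerivAt_const v z)
    have := ((h (Pi.single c 1)).sub ((h (Pi.single c Complex.I)).const_mul Complex.I)).const_mul
      (1 / 2 : ℂ)
    have e : fderiv ℝ (dz n c f) z = _ := this.fderiv
    rw [e]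
    simp
  have two_le : (2 : WithTop ℕ∞) ≤ ((⊤ : ℕ∞) : WithTop ℕ∞) :=
    WithTop.coe_le_coe.mpr (le_top : (2 : ℕ∞) ≤ ⊤)
  have symm : ∀ u v, fderiv ℝ (fderiv ℝ f) z u v = fderiv ℝ (fderiv ℝ f) z v u := fun u v =>
    (hf.contDiffAt.isSymmSndFDerivAt (by simpa using two_le)) u v
  unfold dz at key ⊢
  simp only [key]
  rw [symm (Pi.single b 1) (Pi.single a 1), symm (Pi.single b 1) (Pi.single a Complex.I),
    symm (Pi.single b Complex.I) (Pi.single a 1),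
    symm (Pi.single b Complex.I) (Pi.single a Complex.I)]
  ring

lemma dz_mul {n : ℕ} {f g : (Fin n → ℂ) → ℂ} {z : Fin n → ℂ} (hf : DifferentiableAt ℝ f z)
    (hg : DifferentiableAt ℝ g z) (a : Fin n) :
    dz n a (fun w => f w * g w) z = dz n a f z * g z + f z * dz n a g z := by
  simp only [dz, fderiv_fun_mul hf hg, add_apply,
    smul_apply, smul_eq_mul]
  ring

lemma dz_prod {n : ℕ} {S : Type*} [DecidableEq S] (t : Finset S) {f : S → (Fin n → ℂ) → ℂ}
    {z : Fin n → ℂ} (hf : ∀ s, DifferentiableAt ℝ (f s) z) (a : Fin n) :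
    dz n a (fun w => ∏ s ∈ t, f s w) z =
      ∑ s ∈ t, dz n a (f s) z * ∏ r ∈ t.erase s, f r z := by
  have h : fderiv ℝ (fun w => ∏ s ∈ t, f s w) z = _ :=
    (HasFDerivAt.finsetProd fun s (_ : s ∈ t) => (hf s).hasFDerivAt).fderiv
  simp only [dz, h, sum_apply, smul_apply, smul_eq_mul,
    Finset.mul_sum, ← Finset.sum_sub_distrib]
  exact Finset.sum_congr rfl fun s _ => by ring

lemma integrable_of_smooth {n : ℕ} {f : (Fin n → ℂ) → ℂ} (hf : ContDiff ℝ (⊤ : ℕ∞) f)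
    (hc : HasCompactSupport f) : Integrable f :=
  hf.continuous.integrable_of_hasCompactSupport hc

/-- The Wirtinger derivative of a smooth compactly supported function integrates to zero. -/
lemma integral_dz {n : ℕ} {f : (Fin n → ℂ) → ℂ} (hf : ContDiff ℝ (⊤ : ℕ∞) f)
    (hc : HasCompactSupport f) (a : Fin n) : ∫ z, dz n a f z = 0 := by
  have hint : ∀ v, Integrable fun z => fderiv ℝ f z v := fun v =>
    ((hf.fderiv_right (m := (⊤ : ℕ∞)) (by simp)).clm_apply
      contDiff_const).continuous.integrable_of_hasCompactSupport (hc.fderiv_apply ℝ v)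
  have hzero : ∀ v, ∫ z, fderiv ℝ f z v = 0 := fun v => by
    have := integral_mul_fderiv_eq_neg_fderiv_mul_of_integrable (𝕜 := ℂ) (μ := volume)
      (f := fun _ : Fin n → ℂ => (1 : ℂ)) (g := f) (v := v) (by simp) (by simpa using hint v)
      (by simpa using integrable_of_smooth hf hc) (by fun_prop)
      fun x _ => hf.differentiable (by simp) x
    simpa using this
  simp only [dz]
  rw [integral_const_mul, integral_sub (hint _) ((hint _).const_mul _), integral_const_mul,
    hzero, hzero]
  simp

/-- The second-order terms produced by the Leibniz rule cancel: exchanging two holomorphic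
indices leaves the summand unchanged but reverses the sign of the permutation. -/
lemma sum_sign_dz_dz_eq_zero {n : ℕ} {S : Type*} [Fintype S] [DecidableEq S]
    {g : S → Fin n → (Fin n → ℂ) → ℂ} (hg : ∀ s e, ContDiff ℝ (⊤ : ℕ∞) (g s e)) {s₀ s₁ : S}
    (hs : s₁ ≠ s₀) (z : Fin n → ℂ) :
    ∑ b : S → Fin n, ∑ π : Equiv.Perm S, ((Equiv.Perm.sign π : ℤ) : ℂ) *
      (g s₀ (b (π s₀)) z * (dz n (b s₀) (dz n (b s₁) (g s₁ (b (π s₁)))) z *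
        ∏ r ∈ (Finset.univ.erase s₀).erase s₁, dz n (b r) (g r (b (π r))) z)) = 0 := by
  refine self_eq_neg.mp ?_
  rw [← Finset.sum_neg_distrib]
  refine Fintype.sum_equiv ((Equiv.swap s₀ s₁).arrowCongr (Equiv.refl _)) _ _ fun b => ?_
  rw [← Finset.sum_neg_distrib]
  refine Fintype.sum_equiv (Equiv.mulLeft (Equiv.swap s₀ s₁)) _ _ fun π => ?_
  have hb : ∀ r, (Equiv.swap s₀ s₁).arrowCongr (Equiv.refl (Fin n)) b r
      = b (Equiv.swap s₀ s₁ r) := fun r => by simp [Equiv.arrowCongr]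
  simp only [Equiv.coe_mulLeft, hb, Equiv.Perm.mul_apply, Equiv.swap_apply_self,
    Equiv.Perm.sign_mul, Equiv.Perm.sign_swap hs.symm, Equiv.swap_apply_left,
    Equiv.swap_apply_right]
  rw [dz_comm (hg _ _) (b s₁) (b s₀)]
  have hp : ∏ r ∈ (Finset.univ.erase s₀).erase s₁,
        dz n (b (Equiv.swap s₀ s₁ r)) (g r (b (π r))) z =
      ∏ r ∈ (Finset.univ.erase s₀).erase s₁, dz n (b r) (g r (b (π r))) z := by
    refine Finset.prod_congr rfl fun r hr => ?_
    simp only [Finset.mem_erase] at hr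
    rw [Equiv.swap_apply_of_ne_of_ne hr.2.1 hr.1]
  rw [hp]
  simp

/-- The alternating contraction of first derivatives of smooth functions, one of the families
being compactly supported, is a divergence and so integrates to zero. -/
lemma integral_sum_sign_prod_dz {n : ℕ} {S : Type*} [Fintype S] [DecidableEq S]
    {g : S → Fin n → (Fin n → ℂ) → ℂ} (hg : ∀ s e, ContDiff ℝ (⊤ : ℕ∞) (g s e)) (s₀ : S)
    (hc : ∀ e, HasCompactSupport (g s₀ e)) :
    ∫ z, ∑ b : S → Fin n, ∑ π : Equiv.Perm S, ((Equiv.Perm.sign π : ℤ) : ℂ) *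
      ∏ s, dz n (b s) (g s (b (π s))) z = 0 := by
  set H : (S → Fin n) → Equiv.Perm S → (Fin n → ℂ) → ℂ := fun b π w =>
    g s₀ (b (π s₀)) w * ∏ s ∈ Finset.univ.erase s₀, dz n (b s) (g s (b (π s))) w with hH
  have hP : ∀ (b : S → Fin n) (π : Equiv.Perm S), ContDiff ℝ (⊤ : ℕ∞)
      fun w => ∏ s ∈ Finset.univ.erase s₀, dz n (b s) (g s (b (π s))) w := fun b π =>
    contDiff_prod fun s _ => contDiff_dz (hg s _) _
  have hHs : ∀ b π, ContDiff ℝ (⊤ : ℕ∞) (H b π) := fun b π => (hg _ _).mul (hP b π)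
  have hHc : ∀ b π, HasCompactSupport (H b π) := fun b π => (hc _).mul_right
  have div : ∀ z, ∑ b : S → Fin n, ∑ π : Equiv.Perm S, ((Equiv.Perm.sign π : ℤ) : ℂ) *
      ∏ s, dz n (b s) (g s (b (π s))) z =
      ∑ b : S → Fin n, ∑ π : Equiv.Perm S,
        ((Equiv.Perm.sign π : ℤ) : ℂ) * dz n (b s₀) (H b π) z := by
    intro z
    have leib : ∀ b π, dz n (b s₀) (H b π) z = ∏ s, dz n (b s) (g s (b (π s))) z +
        ∑ s₁ ∈ Finset.univ.erase s₀, g s₀ (b (π s₀)) z *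
          (dz n (b s₀) (dz n (b s₁) (g s₁ (b (π s₁)))) z *
            ∏ r ∈ (Finset.univ.erase s₀).erase s₁, dz n (b r) (g r (b (π r))) z) := by
      intro b π
      rw [hH, dz_mul ((hg _ _).differentiable (by simp) z) ((hP b π).differentiable (by simp) z),
        dz_prod _ fun s => (contDiff_dz (hg s _) _).differentiable (by simp) z, Finset.mul_sum,
        Finset.mul_prod_erase _ (fun s => dz n (b s) (g s (b (π s))) z) (Finset.mem_univ s₀)]
    simp only [leib, mul_add, Finset.sum_add_distrib, left_eq_add, Finset.mul_sum _ _ (Int.cast _)]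
    rw [Finset.sum_congr rfl fun b _ => Finset.sum_comm, Finset.sum_comm]
    exact Finset.sum_eq_zero fun s₁ h₁ =>
      sum_sign_dz_dz_eq_zero hg (Finset.ne_of_mem_erase h₁) z
  have hint : ∀ b π, Integrable fun z =>
      ((Equiv.Perm.sign π : ℤ) : ℂ) * dz n (b s₀) (H b π) z := fun b π =>
    (integrable_of_smooth (contDiff_dz (hHs b π) _) (hasCompactSupport_dz (hHc b π) _)).const_mul _
  simp only [div]
  rw [integral_finsetSum _ fun b _ => integrable_finsetSum _ fun π _ => hint b π]
  refine Finset.sum_eq_zero fun b _ => ?_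
  rw [integral_finsetSum _ fun π _ => hint b π]
  refine Finset.sum_eq_zero fun π _ => ?_
  rw [integral_const_mul, integral_dz (hHs b π) (hHc b π), mul_zero]

/-- every `k`-Chern polynomial of a compactly supported smooth
function integrates to zero. -/
theorem chernPoly_integral_zero (m : ℕ) (hm : 1 ≤ m) (k : Fin m → ℕ)
    (hk : ∀ j, 1 ≤ k j) (n : ℕ) (hn : 1 ≤ n)
    (φ : (Fin n → ℂ) → ℝ) (hφ : SmoothCpt n φ) :
    ∫ z : Fin n → ℂ, chernPoly n m k φ z = 0 := by
  have hφs : ContDiff ℝ (⊤ : ℕ∞) fun w => (φ w : ℂ) := Complex.ofRealCLM.contDiff.comp hφ.1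
  have hφc : HasCompactSupport fun w => (φ w : ℂ) := hφ.2.comp_left Complex.ofReal_zero
  let g : ((Σ j : Fin m, Fin (k j)) → Fin n) → (Σ j : Fin m, Fin (k j)) → Fin n →
      (Fin n → ℂ) → ℂ := fun a s e =>
    dz n (a s) (dzbar n (a ⟨s.1, finRotate (k s.1) s.2⟩) (dzbar n e fun w => (φ w : ℂ)))
  have hgs : ∀ a s e, ContDiff ℝ (⊤ : ℕ∞) (g a s e) := fun a s e =>
    contDiff_dz (contDiff_dzbar (contDiff_dzbar hφs _) _) _
  have hgc : ∀ a s e, HasCompactSupport (g a s e) := fun a s e =>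
    hasCompactSupport_dz (hasCompactSupport_dzbar (hasCompactSupport_dzbar hφc _) _) _
  have hphi : ∀ (a : (Σ j : Fin m, Fin (k j)) → Fin n) s c e,
      phi4 n (a s) c (a ⟨s.1, finRotate (k s.1) s.2⟩) e φ = dz n c (g a s e) := fun a s c e =>
    dz_comm (contDiff_dzbar (contDiff_dzbar hφs _) _) _ _
  simp only [chernPoly, hphi]
  rw [integral_finsetSum]
  · exact Finset.sum_eq_zero fun a _ =>
      integral_sum_sign_prod_dz (hgs a) ⟨⟨0, hm⟩, ⟨0, hk _⟩⟩ (hgc a _)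
  · refine fun a _ => integrable_finsetSum _ fun b _ => integrable_finsetSum _ fun π _ => ?_
    refine (integrable_of_smooth (contDiff_prod fun s _ => contDiff_dz (hgs a s _) _) ?_).const_mul _
    let s₀ : Σ j : Fin m, Fin (k j) := ⟨⟨0, hm⟩, ⟨0, hk _⟩⟩
    refine (hasCompactSupport_dz (hgc a s₀ (b (π s₀))) (b s₀)).mono fun z hz => ?_
    exact Finset.prod_ne_zero_iff.mp hz s₀ (Finset.mem_univ _)

end KahlerInv
end
end

section
/- For every integer k ≥ 2 and every φ ∈ C_c^∞(ℂ^n, ℝ), when the k-Chern polynomial I_k(φ) is expanded as a linear combination of complete contractions of k factors ∂^{(2,2)}φ, its unique term of maximum height is Δφ_{a_1ā_2} · Δφ_{a_2ā_3} · ⋯ · Δφ_{a_kā_1} (with coefficient 1), i.e., I_k(φ) = Δφ_{a_1ā_2}Δφ_{a_2ā_3}⋯Δφ_{a_kā_1} + (a linear combination of complete contractions each of strictly smaller height). -/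
open MeasureTheory

noncomputable section

namespace KahlerInv

/-- The permutation of the slots `Σ _ : Fin k, Fin 2` acting by `ρ` on the first slots and
by `π` on the second slots. -/
def slotPerm {k : ℕ} (ρ π : Equiv.Perm (Fin k)) : Equiv.Perm (Σ _ : Fin k, Fin 2) where
  toFun x := ⟨![ρ, π] x.2 x.1, x.2⟩
  invFun x := ⟨(![ρ, π] x.2).symm x.1, x.2⟩
  left_inv x := by simp
  right_inv x := by simp

/-- The complete contraction of `k` factors `∂^{(2,2)}φ` in which the first (resp. second)
anti-holomorphic slot of the factor `j` is contracted against the first (resp. second)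
holomorphic slot of the factor `ρ j` (resp. `π j`). -/
def permTerm {k : ℕ} (ρ π : Equiv.Perm (Fin k)) : Term k 0 0 where
  A := fun _ => 2
  B := fun _ => 2
  pair := Equiv.sumCongr (slotPerm ρ π).symm (Equiv.refl _)
  okq := fun i => i.elim0
  okp := fun i => i.elim0

lemma permTerm_height_lt {k : ℕ} {ρ π : Equiv.Perm (Fin k)} (hρ : ∀ i, ρ i ≠ i)
    (hπ : π ≠ 1) : (permTerm ρ π).height < k := by
  classical
  obtain ⟨j, hj⟩ : ∃ j, π j ≠ j := by
    by_contra! h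
    exact hπ (Equiv.ext h)
  have key : ∀ s : (permTerm ρ π).HoloIdx,
      (∃ t : (permTerm ρ π).AntiIdx,
        (permTerm ρ π).pair (Sum.inl s) = Sum.inl t ∧ t.1 = s.1) →
      s.2 = (1 : Fin 2) ∧ π s.1 = s.1 := by
    rintro s ⟨t, h, hts⟩
    have hst : slotPerm ρ π t = s :=
      ((slotPerm ρ π).symm_apply_eq.1 (Sum.inl_injective h)).symm
    subst hst
    obtain ⟨i, c⟩ := t
    replace hts : i = (![ρ, π] : Fin 2 → Equiv.Perm (Fin k)) c i := hts
    change c = (1 : Fin 2) ∧ π ((![ρ, π] : Fin 2 → Equiv.Perm (Fin k)) c i) =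
      (![ρ, π] : Fin 2 → Equiv.Perm (Fin k)) c i
    rw [← hts]
    change Fin 2 at c
    fin_cases c
    · exact absurd hts.symm (hρ i)
    · exact ⟨rfl, hts.symm⟩
  have hcard : (permTerm ρ π).height ≤ (Finset.univ.erase j).card := by
    refine Finset.card_le_card_of_injOn (fun s => s.1) ?_ ?_
    · intro s hs
      have h := key s (Finset.mem_filter.1 hs).2
      refine Finset.mem_coe.2 (Finset.mem_erase.2 ⟨fun h' => hj ?_, Finset.mem_univ _⟩)
      exact h' ▸ h.2
    · intro s hs t ht hst
      have h₁ := key s (Finset.mem_filter.1 hs).2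
      have h₂ := key t (Finset.mem_filter.1 ht).2
      exact Sigma.ext hst (heq_of_eq (h₁.1.trans h₂.1.symm))
  have hk : 0 < k := j.pos
  rw [Finset.card_erase_of_mem (Finset.mem_univ j), Finset.card_univ, Fintype.card_fin] at hcard
  omega

/-- Assignments of indices to the slots of `permTerm` are pairs of assignments, one for the
first slots and one for the second slots. -/
def slotAssignEquiv (k n : ℕ) :
    ((Fin k → Fin n) × (Fin k → Fin n)) ≃ (((Σ _ : Fin k, Fin 2) ⊕ Fin 0) → Fin n) where
  toFun ab := Sum.elim (fun x => ![ab.1, ab.2] x.2 x.1) Fin.elim0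
  invFun v := (fun i => v (Sum.inl ⟨i, 0⟩), fun i => v (Sum.inl ⟨i, 1⟩))
  left_inv _ := rfl
  right_inv v := by
    ext x
    rcases x with ⟨i, c⟩ | x
    · fin_cases c <;> rfl
    · exact x.elim0

lemma permTerm_eval {k : ℕ} (ρ π : Equiv.Perm (Fin k)) (n : ℕ) (φ : (Fin n → ℂ) → ℝ)
    (z : Fin n → ℂ) :
    (permTerm ρ π).eval n (fun _ => φ) noFree noFree z =
      ∑ a : Fin k → Fin n, ∑ b : Fin k → Fin n,
        ∏ i, phi4 n (a i) (b i) (a (ρ i)) (b (π i)) φ z := by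
  rw [← Fintype.sum_prod_type'
    (f := fun a b : Fin k → Fin n => ∏ i, phi4 n (a i) (b i) (a (ρ i)) (b (π i)) φ z)]
  refine (Fintype.sum_equiv (slotAssignEquiv k n) _ _ fun ab => ?_).symm
  rw [if_pos ⟨fun i => i.elim0, fun _ i => i.elim0⟩, one_mul]
  rfl

lemma chernPoly_one (k n : ℕ) (φ : (Fin n → ℂ) → ℝ) (z : Fin n → ℂ) :
    chernPoly n 1 (fun _ => k) φ z =
      ∑ π : Equiv.Perm (Fin k), ((Equiv.Perm.sign π : ℤ) : ℂ) *
        (permTerm (finRotate k) π).eval n (fun _ => φ) noFree noFree z := by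
  let e : (Σ _ : Fin 1, Fin k) ≃ Fin k := Equiv.uniqueSigma _
  simp only [permTerm_eval, Finset.mul_sum]
  rw [Finset.sum_comm, chernPoly]
  refine Fintype.sum_equiv (e.arrowCongr (Equiv.refl _)) _ _ fun a => ?_
  rw [Finset.sum_comm]
  refine Fintype.sum_equiv e.permCongr _ _ fun π => ?_
  refine Fintype.sum_equiv (e.arrowCongr (Equiv.refl _)) _ _ fun b => ?_
  rw [Equiv.Perm.sign_permCongr]
  congr 1
  refine Fintype.prod_equiv e _ _ fun s => ?_
  obtain ⟨i, s⟩ := s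
  obtain rfl := Subsingleton.elim 0 i
  simp [e]
  rfl

lemma maxHeightTerm_eq_eval (k n : ℕ) (φ : (Fin n → ℂ) → ℝ) (z : Fin n → ℂ) :
    maxHeightTerm n k φ z =
      (permTerm (finRotate k) 1).eval n (fun _ => φ) noFree noFree z := by
  simp [maxHeightTerm, permTerm_eval, Finset.prod_univ_sum, Fintype.piFinset_univ]

/-- Lemma 4.2: for `k ≥ 2`, the `k`-Chern polynomial `I_k(φ)`
equals `Δφ_{a_1ā_2}Δφ_{a_2ā_3}⋯Δφ_{a_kā_1}` (the unique term of maximum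
height, with coefficient 1) plus a linear combination of complete
contractions of factors `∂^{(2,2)}φ` of strictly smaller height. -/
theorem chern_max_height (k : ℕ) (hk : 2 ≤ k) :
    ∃ L' : LinComb k 0 0,
      (∀ r j, (L'.term r).A j = 2 ∧ (L'.term r).B j = 2) ∧
      (∀ r, (L'.term r).height < k) ∧
      ∀ (n : ℕ) (φ : (Fin n → ℂ) → ℝ), SmoothCpt n φ → ∀ z : Fin n → ℂ,
        chernPoly n 1 (fun _ => k) φ z =
          maxHeightTerm n k φ z + L'.eval n (fun _ => φ) noFree noFree z := by
  classical
  let e := Fintype.equivFin {π : Equiv.Perm (Fin k) // π ≠ 1}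
  refine ⟨⟨_, fun r => ((Equiv.Perm.sign (e.symm r).1 : ℤ) : ℂ),
    fun r => permTerm (finRotate k) (e.symm r).1⟩, fun _ _ => ⟨rfl, rfl⟩,
    fun r => permTerm_height_lt (fun i => ?_) (e.symm r).2, fun n φ _ z => ?_⟩
  · have : i ∈ (finRotate k).support := by simp [support_finRotate_of_le hk]
    exact Equiv.Perm.mem_support.1 this
  · rw [chernPoly_one, maxHeightTerm_eq_eval, Fintype.sum_eq_add_sum_subtype_ne _ 1,
      Equiv.Perm.sign_one, Units.val_one, Int.cast_one, one_mul]
    congr 1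
    exact Fintype.sum_equiv e _ _ fun π => by simp only [Equiv.symm_apply_apply]

end KahlerInv
end
end
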